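/- arXiv:1109.4912 — 3 statements merged into one kernel-verified Lean document; each statement's English description precedes it below -/
import Mathlib

section
/- Let A be an additive subgroup of K^n. Then the ideal poly(A) of polynomial relations of A in K[λ₁,…,λ_n] is generated by the quasi-linear polynomial relations of A, i.e., by those f ∈ poly(A) satisfying f(λ + a) = f(λ) + f(a) in K[λ₁,…,λ_n] for every a ∈ A. -/
/-- The ideal `poly(A)` of polynomial relations of a subset `A ⊆ K^n`: all polynomials
in `K[λ₁,…,λ_n]` vanishing at every point of `A`. -/
def polyIdeal {K : Type*} [Field K] {n : ℕ} (A : Set (Fin n → K)) :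
    Ideal (MvPolynomial (Fin n) K) where
  carrier := {f | ∀ a ∈ A, MvPolynomial.eval a f = 0}
  zero_mem' := by intro a _; simp
  add_mem' := by intro f g hf hg a ha; simp [hf a ha, hg a ha]
  smul_mem' := by intro c f hf a ha; simp [hf a ha]

/-- `f` is quasi-linear with respect to `A`: `f(λ + a) = f(λ) + f(a)` as polynomials,
for every `a ∈ A`. -/
def QuasiLinear {K : Type*} [Field K] {n : ℕ} (A : Set (Fin n → K))
    (f : MvPolynomial (Fin n) K) : Prop :=
  ∀ a ∈ A,
    MvPolynomial.aeval (fun i => MvPolynomial.X i + MvPolynomial.C (a i)) f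
      = f + MvPolynomial.C (MvPolynomial.eval a f)

open MvPolynomial in
theorem shift_support {K : Type*} [Field K] {n : ℕ} (a : Fin n → K)
    (p : MvPolynomial (Fin n) K) (t : Fin n →₀ ℕ)
    (ht : t ∈ (aeval (fun i => X i + C (a i)) p - p).support) : ∃ s ∈ p.support, t < s := by
  classical
  have key : ∀ (s : Fin n →₀ ℕ) (c : K), ∀ t ∈ (aeval (fun i => X i + C (a i)) (monomial s c)
      - monomial s c : MvPolynomial (Fin n) K).support,
      ∃ s' ∈ (monomial s c : MvPolynomial (Fin n) K).support, t < s' := by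
    intro s c
    refine induction_on_monomial (motive := fun p : MvPolynomial (Fin n) K =>
      ∀ t ∈ (aeval (fun i => X i + C (a i)) p - p).support, ∃ s' ∈ p.support, t < s') ?_ ?_ s c
    · intro c t ht
      simp [algebraMap_eq] at ht
    · intro p i ih t ht
      have e : aeval (fun i => X i + C (a i)) (p * X i) - p * X i =
          (aeval (fun i => X i + C (a i)) p - p) * X i +
            (C (a i) * (aeval (fun i => X i + C (a i)) p - p) + C (a i) * p) := by
        simp only [map_mul, aeval_X]; ring
      have hlt : ∀ s : Fin n →₀ ℕ, s < s + Finsupp.single i 1 := fun s =>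
        lt_add_of_pos_right _ (by
          rw [pos_iff_ne_zero]; simp)
      have hm : ∀ s ∈ p.support, s + Finsupp.single i 1 ∈ (p * X i).support := by
        intro s hs
        rw [mem_support_iff] at hs ⊢
        rwa [coeff_mul_X]
      rw [e] at ht
      rcases Finset.mem_union.1 (support_add ht) with h | h
      · rw [support_mul_X, Finset.mem_map] at h
        obtain ⟨u, hu, rfl⟩ := h
        obtain ⟨s', hs', hl⟩ := ih u hu
        exact ⟨_, hm s' hs', by simpa using hl⟩
      · rcases Finset.mem_union.1 (support_add h) with h | h
        · have h' : t ∈ (aeval (fun i => X i + C (a i)) p - p).support := by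
            rw [mem_support_iff, coeff_C_mul] at h
            exact mem_support_iff.2 (right_ne_zero_of_mul h)
          obtain ⟨s', hs', hl⟩ := ih t h'
          exact ⟨_, hm s' hs', hl.trans (hlt s')⟩
        · have h' : t ∈ p.support := by
            rw [mem_support_iff, coeff_C_mul] at h
            exact mem_support_iff.2 (right_ne_zero_of_mul h)
          exact ⟨_, hm t h', hlt t⟩
  have e : aeval (fun i => X i + C (a i)) p - p = ∑ s ∈ p.support,
      (aeval (fun i => X i + C (a i)) (monomial s (coeff s p)) - monomial s (coeff s p)) := by
    rw [Finset.sum_sub_distrib, ← map_sum, ← p.as_sum]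
  rw [e] at ht
  obtain ⟨s, hs, h⟩ := Finset.mem_biUnion.1 (support_sum ht)
  obtain ⟨s', hs', hl⟩ := key s _ t h
  have := Finset.mem_singleton.1 (support_monomial_subset hs')
  exact ⟨s, hs, this ▸ hl⟩

open MvPolynomial in
theorem shift_mem {K : Type*} [Field K] {n : ℕ} {A : Set (Fin n → K)}
    (hadd : ∀ x ∈ A, ∀ y ∈ A, x + y ∈ A) {a : Fin n → K} (ha : a ∈ A)
    {f : MvPolynomial (Fin n) K} (hf : f ∈ polyIdeal A) :
    aeval (fun i => X i + C (a i)) f ∈ polyIdeal A := by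
  intro b hb
  have h := hf (b + a) (hadd b hb a ha)
  have e : eval b (aeval (fun i => X i + C (a i)) f) = eval (b + a) f := by
    rw [← coe_aeval_eq_eval, ← coe_aeval_eq_eval]
    change ((aeval b).comp (aeval (fun i => X i + C (a i)))) f = aeval (b + a) f
    congr 1
    ext i
    simp
  rw [e]; exact h

/-- for an additive subgroup `A` of `K^n`, the ideal `poly(A)` of polynomial
relations of `A` is generated by the quasi-linear polynomial relations of `A`. -/
theorem stmt_13 {K : Type*} [Field K] [IsAlgClosed K] {n : ℕ} (A : Set (Fin n → K))
    (h0 : (0 : Fin n → K) ∈ A)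
    (hadd : ∀ x ∈ A, ∀ y ∈ A, x + y ∈ A)
    (hneg : ∀ x ∈ A, -x ∈ A) :
    Ideal.span {f | f ∈ polyIdeal A ∧ QuasiLinear A f} = polyIdeal A := by
  classical
  apply le_antisymm
  · exact Ideal.span_le.2 fun f hf => hf.1
  let m : MonomialOrder (Fin n) := MonomialOrder.lex
  -- elements supported on standard monomials vanish
  have hstd : ∀ g ∈ polyIdeal A,
      (∀ t ∈ g.support, ¬ ∃ g' ∈ polyIdeal A, g' ≠ 0 ∧ m.degree g' = t) → g = 0 := by
    intro g hg h
    by_contra hg0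
    exact h _ (m.degree_mem_support hg0) ⟨g, hg, hg0, rfl⟩
  have hunit : ∀ g : MvPolynomial (Fin n) K, g ≠ 0 → IsUnit (m.leadingCoeff g) :=
    fun g hg => (m.leadingCoeff_ne_zero_iff.2 hg).isUnit
  intro f hf
  obtain ⟨q, r, hfr, -, hr⟩ := m.div_set
    (B := {f | (f ∈ polyIdeal A ∧ QuasiLinear A f) ∧ f ≠ 0}) (fun b hb => hunit b hb.2) f
  have hq : Finsupp.linearCombination (MvPolynomial (Fin n) K)
      (fun (b : {f | (f ∈ polyIdeal A ∧ QuasiLinear A f) ∧ f ≠ 0}) =>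
        (b : MvPolynomial (Fin n) K)) q ∈ Ideal.span {f | f ∈ polyIdeal A ∧ QuasiLinear A f} := by
    rw [Finsupp.linearCombination_apply, Finsupp.sum]
    exact Ideal.sum_mem _ fun b _ => Ideal.mul_mem_left _ _ (Ideal.subset_span b.2.1)
  have hsub : Ideal.span {f | f ∈ polyIdeal A ∧ QuasiLinear A f} ≤ polyIdeal A :=
    Ideal.span_le.2 fun f hf => hf.1
  have hrI : r ∈ polyIdeal A := by
    have : r = f - Finsupp.linearCombination (MvPolynomial (Fin n) K)
      (fun (b : {f | (f ∈ polyIdeal A ∧ QuasiLinear A f) ∧ f ≠ 0}) =>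
        (b : MvPolynomial (Fin n) K)) q := by rw [eq_sub_iff_add_eq', ← hfr]
    rw [this]
    exact Ideal.sub_mem _ hf (hsub hq)
  suffices h : r = 0 by
    rw [hfr, h, add_zero]; exact hq
  by_contra hr0
  -- a minimal degree below `degree r`
  obtain ⟨d, ⟨hdr, g0, hg0I, hg00, hg0d⟩, hmin⟩ :=
    (wellFounded_lt (α := Fin n →₀ ℕ)).has_min
      {d | d ≤ m.degree r ∧ ∃ g' ∈ polyIdeal A, g' ≠ 0 ∧ m.degree g' = d}
      ⟨_, le_rfl, r, hrI, hr0, rfl⟩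
  obtain ⟨q', s, hs, -, hs'⟩ := m.div_set
    (B := {f | f ∈ polyIdeal A ∧ f ≠ 0}) (fun b hb => hunit b hb.2)
    (MvPolynomial.monomial d (1 : K))
  have hsI : MvPolynomial.monomial d (1 : K) - s ∈ polyIdeal A := by
    rw [hs, add_sub_cancel_right, Finsupp.linearCombination_apply, Finsupp.sum]
    exact Ideal.sum_mem _ fun b _ => Ideal.mul_mem_left _ _ b.2.1
  have hds : d ∉ s.support := fun h => hs' d h g0 ⟨hg0I, hg00⟩ hg0d.le
  set g := MvPolynomial.monomial d (1 : K) - s with hg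
  have hcd : MvPolynomial.coeff d g = 1 := by
    rw [hg, MvPolynomial.coeff_sub, MvPolynomial.notMem_support_iff.1 hds]; simp
  have hgne : g ≠ 0 := by
    intro h; rw [h] at hcd; simp at hcd
  have hsupp : ∀ t ∈ g.support, t = d ∨ t ∈ s.support := by
    intro t ht
    rcases Finset.mem_union.1 (MvPolynomial.support_sub _ _ _ ht) with h | h
    · exact Or.inl (Finset.mem_singleton.1 (MvPolynomial.support_monomial_subset h))
    · exact Or.inr h
  have hdeg : m.degree g = d := by
    rcases hsupp _ (m.degree_mem_support hgne) with h | h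
    · exact h
    · exact absurd le_rfl (hs' _ h g ⟨hsI, hgne⟩)
  have hinv : QuasiLinear A g := by
    intro a ha
    rw [hsI a ha, map_zero, add_zero, ← sub_eq_zero]
    apply hstd _ (Ideal.sub_mem _ (shift_mem hadd ha hsI) hsI)
    rintro t ht ⟨g', hg'I, hg'0, hg't⟩
    obtain ⟨u, hu, htu⟩ := shift_support a g t ht
    rcases hsupp u hu with rfl | h
    · exact hmin t ⟨htu.le.trans hdr, g', hg'I, hg'0, hg't⟩ htu
    · exact hs' u h g' ⟨hg'I, hg'0⟩ (hg't.le.trans htu.le)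
  exact hr _ (m.degree_mem_support hr0) g ⟨⟨hsI, hinv⟩, hgne⟩ (hdeg.le.trans hdr)
end

section
/- Let F be a subfield of K and let A be an F-subspace of K^n. Then the ideal poly(A) of polynomial relations of A in K[λ₁,…,λ_n] is generated by the quasi-linear F-homogeneous polynomial relations of A, i.e., by those f ∈ poly(A) satisfying f(λ + a) = f(λ) + f(a) for every a ∈ A and for which there exists d ∈ ℕ, d ≥ 1, with f(αλ₁,…,αλ_n) = α^d f(λ₁,…,λ_n) for every α ∈ F. -/
/-- `f` is `F`-homogeneous: there is `d ≥ 1` with `f(αλ₁,…,αλ_n) = α^d f(λ₁,…,λ_n)`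
for every `α ∈ F`. -/
def IsFHomogeneous {K : Type*} [Field K] (F : Subfield K) {n : ℕ}
    (f : MvPolynomial (Fin n) K) : Prop :=
  ∃ d : ℕ, 1 ≤ d ∧ ∀ α : F,
    MvPolynomial.aeval (fun i => MvPolynomial.C (α : K) * MvPolynomial.X i) f
      = MvPolynomial.C ((α : K) ^ d) * f

open MvPolynomial in
/-- Support of a translate of a monomial. -/
lemma trans_monomial_aux {K : Type*} [Field K] {n : ℕ} (a : Fin n → K) (e : Fin n →₀ ℕ) :
    ∀ c ∈ (aeval (fun i => X i + C (a i)) (monomial e (1 : K)) - monomial e (1 : K)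
      : MvPolynomial (Fin n) K).support, c < e := by
  classical
  set T : MvPolynomial (Fin n) K →ₐ[K] MvPolynomial (Fin n) K :=
    aeval (fun i => X i + C (a i)) with hT
  have addstep : ∀ u v : Fin n →₀ ℕ,
      (∀ c ∈ (T (monomial u 1) - monomial u 1).support, c < u) →
      (∀ c ∈ (T (monomial v 1) - monomial v 1).support, c < v) →
      (∀ c ∈ (T (monomial (u + v) 1) - monomial (u + v) 1).support, c < u + v) := by
    intro u v hu hv c hc
    have hm : (monomial (u + v) (1 : K)) = monomial u 1 * monomial v 1 := by
      rw [monomial_mul, one_mul]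
    have key : T (monomial (u + v) 1) - monomial (u + v) 1
        = monomial u 1 * (T (monomial v 1) - monomial v 1)
          + (T (monomial u 1) - monomial u 1) * monomial v 1
          + (T (monomial u 1) - monomial u 1) * (T (monomial v 1) - monomial v 1) := by
      rw [hm, map_mul]; ring
    rw [key] at hc
    have h1 : ∀ w : Fin n →₀ ℕ, ∀ c ∈ (monomial w (1 : K)).support, c = w := by
      intro w c hc
      have := support_monomial_subset hc
      simpa using this
    rcases Finset.mem_union.1 (support_add hc) with hc | hc
    · rcases Finset.mem_union.1 (support_add hc) with hc | hc
      · obtain ⟨x, hx, y, hy, rfl⟩ := Finset.mem_add.1 (support_mul _ _ hc)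
        rw [h1 _ _ hx]
        exact add_lt_add_of_le_of_lt le_rfl (hv y hy)
      · obtain ⟨x, hx, y, hy, rfl⟩ := Finset.mem_add.1 (support_mul _ _ hc)
        rw [h1 _ _ hy]
        exact add_lt_add_of_lt_of_le (hu x hx) le_rfl
    · obtain ⟨x, hx, y, hy, rfl⟩ := Finset.mem_add.1 (support_mul _ _ hc)
      exact add_lt_add (hu x hx) (hv y hy)
  have zero : ∀ c ∈ (T (monomial 0 1) - monomial 0 1).support, c < 0 := by
    intro c hc
    have h : (monomial 0 (1 : K) : MvPolynomial (Fin n) K) = 1 := rfl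
    rw [h, map_one, sub_self] at hc
    simp at hc
  induction e using Finsupp.induction_linear with
  | zero => exact zero
  | add u v hu hv => exact addstep u v hu hv
  | single i k =>
    induction k with
    | zero => simp
    | succ k ih =>
      rw [Finsupp.single_add]
      refine addstep _ _ ih ?_
      intro c hc
      have h : T (monomial (Finsupp.single i 1) 1) - monomial (Finsupp.single i 1) 1
          = monomial 0 (a i) := by
        change T (X i) - X i = C (a i)
        rw [hT, aeval_X]; ring
      rw [h] at hc
      have := support_monomial_subset hc
      rw [Finset.mem_singleton] at this
      rw [this]
      exact pos_iff_ne_zero.2 (by simp)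

open MvPolynomial in
/-- Support of a translate. -/
lemma trans_support_aux {K : Type*} [Field K] {n : ℕ} (a : Fin n → K)
    (f : MvPolynomial (Fin n) K) :
    ∀ c ∈ (aeval (fun i => X i + C (a i)) f - f
      : MvPolynomial (Fin n) K).support, ∃ e ∈ f.support, c < e := by
  classical
  intro c hc
  have key : (aeval (fun i => X i + C (a i)) f - f : MvPolynomial (Fin n) K)
      = ∑ e ∈ f.support, (coeff e f) •
        (aeval (fun i => X i + C (a i)) (monomial e (1 : K)) - monomial e (1 : K)) := by
    have hf : f = ∑ e ∈ f.support, (coeff e f) • monomial e (1 : K) := by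
      conv_lhs => rw [f.as_sum]
      refine Finset.sum_congr rfl fun e _ => ?_
      rw [smul_monomial, smul_eq_mul, mul_one]
    simp only [smul_sub, Finset.sum_sub_distrib]
    rw [← hf]
    congr 1
    conv_lhs => rw [hf]
    rw [map_sum]
    simp only [map_smul]
  rw [key] at hc
  obtain ⟨e, he, hc⟩ := Finset.mem_biUnion.1 (support_sum hc)
  exact ⟨e, he, trans_monomial_aux a e c (support_smul hc)⟩

open MvPolynomial in
/-- Coefficients of a rescaled polynomial. -/
lemma scale_coeff_aux {K : Type*} [Field K] {n : ℕ} (α : K)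
    (f : MvPolynomial (Fin n) K) (c : Fin n →₀ ℕ) :
    coeff c (aeval (fun i => C α * X i) f : MvPolynomial (Fin n) K)
      = α ^ c.degree * coeff c f := by
  classical
  induction f using MvPolynomial.induction_on' with
  | monomial e r =>
    have h : (aeval (fun i => C α * X i) (monomial e r) : MvPolynomial (Fin n) K)
        = monomial e (α ^ e.degree * r) := by
      rw [aeval_monomial]
      simp only [mul_pow, Finsupp.prod_mul]
      have h1 : (e.prod fun _ k => (C α : MvPolynomial (Fin n) K) ^ k) = C (α ^ e.degree) := by
        rw [Finsupp.prod, Finset.prod_pow_eq_pow_sum, Finsupp.degree, map_pow]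
        rfl
      rw [h1, mul_comm (α ^ _) r, monomial_eq (a := r * _), C_mul, algebraMap_eq, mul_assoc]
    rw [h, coeff_monomial, coeff_monomial]
    split_ifs with h
    · rw [h]
    · simp
  | add p q hp hq => rw [map_add, coeff_add, coeff_add, hp, hq, mul_add]

/-- for an `F`-subspace `A` of `K^n` (`F` a subfield of `K`), the ideal
`poly(A)` is generated by the quasi-linear `F`-homogeneous polynomial relations of `A`. -/
theorem stmt_14 {K : Type*} [Field K] [IsAlgClosed K] (F : Subfield K) {n : ℕ}
    (A : Set (Fin n → K))
    (h0 : (0 : Fin n → K) ∈ A)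
    (hadd : ∀ x ∈ A, ∀ y ∈ A, x + y ∈ A)
    (hsmul : ∀ (c : F), ∀ x ∈ A, (c : K) • x ∈ A) :
    Ideal.span {f | f ∈ polyIdeal A ∧ QuasiLinear A f ∧ IsFHomogeneous F f}
      = polyIdeal A := by
  classical
  apply le_antisymm
  · rw [Ideal.span_le]
    exact fun f hf => hf.1
  set J := polyIdeal A with hJ
  have memJ : ∀ f, f ∈ J ↔ ∀ a ∈ A, MvPolynomial.eval a f = 0 := fun f => Iff.rfl
  let m : MonomialOrder (Fin n) := MonomialOrder.lex
  let Std : (Fin n →₀ ℕ) → Prop := fun c => ∀ b ∈ J, b ≠ 0 → ¬ m.degree b ≤ c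
  have std_zero : ∀ p ∈ J, (∀ c ∈ p.support, Std c) → p = 0 := by
    intro p hp h
    by_contra hne
    exact h _ (m.degree_mem_support hne) p hp hne le_rfl
  have unitlc : ∀ b : MvPolynomial (Fin n) K, b ≠ 0 → IsUnit (m.leadingCoeff b) := by
    intro b hb
    exact (m.leadingCoeff_ne_zero_iff.2 hb).isUnit
  -- division by a set of elements of `J`
  have divJ : ∀ B : Set (MvPolynomial (Fin n) K), (∀ b ∈ B, b ≠ 0) → ∀ f,
      ∃ h ∈ Ideal.span B, ∃ r, f = h + r ∧ ∀ c ∈ r.support, ∀ b ∈ B, ¬ m.degree b ≤ c := by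
    intro B hB f
    obtain ⟨g, r, hf, -, hr⟩ := m.div_set (B := B) (fun b hb => unitlc b (hB b hb)) f
    refine ⟨_, ?_, r, hf, hr⟩
    rw [Finsupp.linearCombination_apply]
    refine Ideal.sum_mem _ fun b _ => ?_
    exact Ideal.mul_mem_left _ _ (Ideal.subset_span b.2)
  -- reduced Groebner basis elements
  have gb : ∀ e : Fin n →₀ ℕ, ¬ Std e → (∀ c, c < e → Std c) →
      ∃ g, (g ∈ J ∧ QuasiLinear A g ∧ IsFHomogeneous F g) ∧ g ≠ 0 ∧ m.degree g = e := by
    intro e he hmin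
    obtain ⟨g, hg, r, hgr, hr⟩ := divJ {b | b ∈ J ∧ b ≠ 0} (fun b hb => hb.2)
      (MvPolynomial.monomial e 1)
    have hgJ : g ∈ J := (Ideal.span_le.2 (fun b hb => hb.1) : Ideal.span _ ≤ J) hg
    have hrS : ∀ c ∈ r.support, Std c := fun c hc b hb hb0 => hr c hc b ⟨hb, hb0⟩
    have hge : MvPolynomial.coeff e g = 1 := by
      have h1 : MvPolynomial.coeff e r = 0 := by
        by_contra h
        exact he (hrS e (MvPolynomial.mem_support_iff.2 h))
      have h2 := congrArg (MvPolynomial.coeff e) hgr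
      rw [MvPolynomial.coeff_add, h1, add_zero, MvPolynomial.coeff_monomial, if_pos rfl] at h2
      exact h2.symm
    have hgS : ∀ c ∈ g.support, c = e ∨ Std c := by
      intro c hc
      by_cases hce : c = e
      · exact Or.inl hce
      · right
        apply hrS
        have h2 := congrArg (MvPolynomial.coeff c) hgr
        rw [MvPolynomial.coeff_add, MvPolynomial.coeff_monomial, if_neg (Ne.symm hce)] at h2
        rw [MvPolynomial.mem_support_iff] at hc ⊢
        intro h
        rw [h, add_zero] at h2
        exact hc h2.symm
    have hg0 : g ≠ 0 := by
      rintro rfl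
      simp at hge
    have e0 : e ≠ 0 := by
      rintro rfl
      have := (memJ g).1 hgJ 0 h0
      rw [MvPolynomial.eval_zero, MvPolynomial.constantCoeff_eq, hge] at this
      exact one_ne_zero this
    refine ⟨g, ⟨hgJ, ?_, ?_⟩, hg0, ?_⟩
    · intro a ha
      rw [(memJ g).1 hgJ a ha, map_zero, add_zero, ← sub_eq_zero]
      apply std_zero
      · rw [memJ]
        intro b hb
        rw [map_sub, (memJ g).1 hgJ b hb, sub_zero]
        have h := (memJ g).1 hgJ (b + a) (hadd b hb a ha)
        rw [← h, MvPolynomial.aeval_def, MvPolynomial.eval₂_eq', map_sum,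
          MvPolynomial.eval_eq']
        simp [MvPolynomial.algebraMap_eq]
      · intro c hc
        obtain ⟨k, hk, hlt⟩ := trans_support_aux a g c hc
        rcases hgS k hk with rfl | hs
        · exact hmin c hlt
        · exact fun b hb hb0 hle => hs b hb hb0 (hle.trans hlt.le)
    · refine ⟨e.degree, ?_, ?_⟩
      · rw [Nat.one_le_iff_ne_zero]
        intro h
        exact e0 ((Finsupp.degree_eq_zero_iff e).1 h)
      · intro α
        rw [← sub_eq_zero]
        apply std_zero
        · rw [memJ]
          intro b hb
          rw [map_sub, map_mul, (memJ g).1 hgJ b hb, mul_zero, sub_zero]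
          have h := (memJ g).1 hgJ ((α : K) • b) (hsmul α b hb)
          rw [← h, MvPolynomial.aeval_def, MvPolynomial.eval₂_eq', map_sum,
            MvPolynomial.eval_eq']
          simp [MvPolynomial.algebraMap_eq]
        · intro c hc
          rw [MvPolynomial.mem_support_iff, MvPolynomial.coeff_sub, scale_coeff_aux,
            MvPolynomial.coeff_C_mul] at hc
          have hcg : c ∈ g.support := by
            rw [MvPolynomial.mem_support_iff]
            intro h
            rw [h] at hc
            simp at hc
          rcases hgS c hcg with rfl | hs
          · simp at hc
          · exact hs
    · rcases hgS _ (m.degree_mem_support hg0) with h | h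
      · exact h
      · exact absurd le_rfl (h g hgJ hg0)
  intro f hf
  set G : Set (MvPolynomial (Fin n) K) :=
    {f | f ∈ J ∧ QuasiLinear A f ∧ IsFHomogeneous F f} with hG
  obtain ⟨h, hh, r, hfr, hr⟩ := divJ {b | b ∈ G ∧ b ≠ 0} (fun b hb => hb.2) f
  have hhG : h ∈ Ideal.span G := Ideal.span_mono (fun b hb => hb.1) hh
  have hhJ : h ∈ J := (Ideal.span_le.2 (fun b hb => hb.1) : Ideal.span G ≤ J) hhG
  have hrJ : r ∈ J := by
    have : r = f - h := by rw [hfr]; ring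
    rw [this]
    exact J.sub_mem hf hhJ
  have hr0 : r = 0 := by
    by_contra hne
    have hns : ¬ Std (m.degree r) := fun hs => hs r hrJ hne le_rfl
    obtain ⟨e, ⟨hes, hele⟩, hemin⟩ := (wellFounded_lt (α := Fin n →₀ ℕ)).has_min
      {e | ¬ Std e ∧ e ≤ m.degree r} ⟨_, hns, le_rfl⟩
    obtain ⟨g, hgG, hg0, hge⟩ := gb e hes (fun c hc => by
      by_contra hcs
      exact hemin c ⟨hcs, hc.le.trans hele⟩ hc)
    exact hr _ (m.degree_mem_support hne) g ⟨hgG, hg0⟩ (hge ▸ hele)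
  rw [hfr, hr0, add_zero]
  exact hhG
end

section
/- Suppose K has characteristic p > 0, and let A be an additive subgroup of K^n. Then the ideal poly(A) of polynomial relations of A is generated by polynomial relations of weak Frobenius type, i.e., by relations of the form Σ_{i=1}^n Σ_{j≥1} c_{ij} λ_i^{q_{ij}}, where c_{ij} ∈ K and each exponent q_{ij} is a power of p. -/
/-- `f` is of weak Frobenius type with base `p`: a finite sum
`Σ_i Σ_j c_{ij} λ_i^{q_{ij}}` in which every exponent `q_{ij}` is a power of `p`. -/
def WeakFrobeniusType {K : Type*} [Field K] (p : ℕ) {n : ℕ}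
    (f : MvPolynomial (Fin n) K) : Prop :=
  ∃ (N : ℕ) (c : Fin n → Fin N → K) (e : Fin n → Fin N → ℕ),
    f = ∑ i : Fin n, ∑ j : Fin N,
      MvPolynomial.C (c i j) * MvPolynomial.X i ^ p ^ (e i j)

/-- A univariate additive polynomial is a `p`-polynomial. -/
theorem additive_univ {K : Type*} [Field K] [IsAlgClosed K] {p : ℕ} [CharP K p] (hp : p.Prime)
    (M : ℕ) : ∀ g : Polynomial K, g.natDegree < M →
      (∀ x y, g.eval (x + y) = g.eval x + g.eval y) →
      ∃ c : ℕ → K, g = ∑ j ∈ Finset.range M, Polynomial.C (c j) * Polynomial.X ^ p ^ j := by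
  have : Fact p.Prime := ⟨hp⟩
  have hinf : Infinite K := IsAlgClosed.instInfinite
  induction M with
  | zero => intro g hg; omega
  | succ M ih =>
    intro g hg hadd
    have hg0 : g.eval 0 = 0 := by simpa using hadd 0 0
    rcases Nat.eq_zero_or_pos M with hM | hM
    · have hd : g.natDegree = 0 := by omega
      refine ⟨0, ?_⟩
      rw [Polynomial.eq_C_of_natDegree_eq_zero hd] at hg0 ⊢
      simp at hg0
      simp [hg0]
    have hder : Polynomial.derivative g = Polynomial.C (g.coeff 1) := by
      apply Polynomial.funext
      intro b
      have h1 : Polynomial.taylor b g = g + Polynomial.C (g.eval b) := by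
        apply Polynomial.funext
        intro x
        rw [Polynomial.taylor_eval, hadd]; simp
      have h2 := congrArg (fun q => q.coeff 1) h1
      simp only [Polynomial.taylor_coeff_one] at h2
      rw [h2]
      simp
    set g1 := g - Polynomial.C (g.coeff 1) * Polynomial.X with hg1
    have hd1 : Polynomial.derivative g1 = 0 := by simp [hg1, hder]
    have hex := Polynomial.expand_contract p hd1 hp.ne_zero
    set h := Polynomial.contract p g1 with hh
    have hev : ∀ x, h.eval (x ^ p) = g.eval x - g.coeff 1 * x := by
      intro x
      rw [← Polynomial.expand_eval, hex]; simp [hg1]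
    have hdeg : h.natDegree < M := by
      have e1 : h.natDegree * p = g1.natDegree := by rw [← hex, Polynomial.natDegree_expand]
      have e2 : g1.natDegree ≤ M := by
        refine (Polynomial.natDegree_sub_le _ _).trans (max_le (by omega) ?_)
        exact (Polynomial.natDegree_C_mul_le _ _).trans (Polynomial.natDegree_X_le.trans hM)
      have := hp.two_le
      by_contra hc
      nlinarith
    obtain ⟨c, hc⟩ := ih h hdeg (by
      intro x y
      obtain ⟨x', rfl⟩ := IsAlgClosed.exists_pow_nat_eq x hp.pos
      obtain ⟨y', rfl⟩ := IsAlgClosed.exists_pow_nat_eq y hp.pos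
      rw [← add_pow_char, hev, hev, hev, hadd]; ring)
    refine ⟨fun j => Nat.casesOn j (g.coeff 1) c, ?_⟩
    rw [Finset.sum_range_succ']
    have : g = Polynomial.expand K p h + Polynomial.C (g.coeff 1) * Polynomial.X := by
      rw [hex, hg1]; ring
    conv_lhs => rw [this, hc]
    simp only [map_sum, map_mul, Polynomial.expand_C, map_pow, Polynomial.expand_X, pow_zero,
      pow_one]
    congr 1
    refine Finset.sum_congr rfl fun j _ => ?_
    rw [← pow_mul, pow_succ']

theorem additive_weak {K : Type*} [Field K] [IsAlgClosed K] {p : ℕ} [CharP K p] (hp : p.Prime)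
    {n : ℕ} (f : MvPolynomial (Fin n) K)
    (hf : ∀ x y, MvPolynomial.eval (x + y) f = MvPolynomial.eval x f + MvPolynomial.eval y f) :
    WeakFrobeniusType p f := by
  have hinf : Infinite K := IsAlgClosed.instInfinite
  let φ : (Fin n → K) →+ K := AddMonoidHom.mk' (fun x => MvPolynomial.eval x f) hf
  let g : Fin n → Polynomial K := fun i =>
    MvPolynomial.aeval (fun j => if j = i then Polynomial.X else 0) f
  have hg : ∀ i x, (g i).eval x = φ (Pi.single i x) := by
    intro i x
    simp only [g, φ, AddMonoidHom.mk'_apply]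
    rw [← Polynomial.coe_evalRingHom, MvPolynomial.aeval_def, MvPolynomial.hom_eval₂,
      MvPolynomial.eval, MvPolynomial.coe_eval₂Hom]
    congr 1
    · ext; simp
    · funext j
      by_cases h : j = i
      · subst h; simp
      · simp [h]
  let M := (Finset.univ.sup fun i => (g i).natDegree) + 1
  have hM : ∀ i, (g i).natDegree < M := fun i =>
    Nat.lt_succ_of_le (Finset.le_sup (f := fun i => (g i).natDegree) (Finset.mem_univ i))
  choose c hc using fun i => additive_univ hp M (g i) (hM i) (by
    intro x y
    rw [hg, hg, hg, Pi.single_add, map_add])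
  refine ⟨M, fun i j => c i j, fun i j => j, ?_⟩
  apply MvPolynomial.funext
  intro x
  have h1 : MvPolynomial.eval x f = ∑ i, φ (Pi.single i (x i)) := by
    rw [← map_sum, Finset.univ_sum_single]; rfl
  rw [h1, map_sum]
  refine Finset.sum_congr rfl fun i _ => ?_
  rw [← hg, hc i, Polynomial.eval_finsetSum, Finset.sum_range]
  simp

noncomputable def shiftBy {K : Type*} [Field K] {n : ℕ} (b : Fin n → K) :
    MvPolynomial (Fin n) K →ₐ[K] MvPolynomial (Fin n) K :=
  MvPolynomial.aeval (fun i => MvPolynomial.X i + MvPolynomial.C (b i))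

theorem eval_shiftBy {K : Type*} [Field K] {n : ℕ} (b x : Fin n → K)
    (f : MvPolynomial (Fin n) K) :
    MvPolynomial.eval x (shiftBy b f) = MvPolynomial.eval (x + b) f := by
  induction f using MvPolynomial.induction_on with
  | C a => simp [shiftBy]
  | add p q hp hq => simp [hp, hq]
  | mul_X p i hp => rw [map_mul, map_mul, hp]; simp [shiftBy]

theorem shiftBy_step {K : Type*} [Field K] {n : ℕ} (b : Fin n → K) (d : Fin n →₀ ℕ) (i : Fin n)
    (h : shiftBy b (MvPolynomial.monomial d 1) - MvPolynomial.monomial d 1 ∈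
      MvPolynomial.restrictSupport K {c | c < d}) :
    shiftBy b (MvPolynomial.monomial (d + Finsupp.single i 1) 1) -
      MvPolynomial.monomial (d + Finsupp.single i 1) 1 ∈
      MvPolynomial.restrictSupport K {c | c < d + Finsupp.single i 1} := by
  have hlt : d < d + Finsupp.single i 1 :=
    lt_add_of_pos_right d (pos_iff_ne_zero.mpr (by simp))
  set r := shiftBy b (MvPolynomial.monomial d 1) - MvPolynomial.monomial d 1 with hr
  have hm : (MvPolynomial.monomial (d + Finsupp.single i 1) (1 : K)) =
      MvPolynomial.monomial d 1 * MvPolynomial.X i := by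
    simp [MvPolynomial.X]
  have key : shiftBy b (MvPolynomial.monomial (d + Finsupp.single i 1) 1) -
      MvPolynomial.monomial (d + Finsupp.single i 1) 1 =
      r * MvPolynomial.X i + b i • MvPolynomial.monomial d 1 + b i • r := by
    have h1 : shiftBy b (MvPolynomial.monomial d 1) = MvPolynomial.monomial d 1 + r := by
      rw [hr]; ring
    rw [hm, map_mul, h1]
    simp only [shiftBy, MvPolynomial.aeval_X, MvPolynomial.smul_eq_C_mul]
    ring
  rw [key]
  refine Submodule.add_mem _ (Submodule.add_mem _ ?_ (Submodule.smul_mem _ _ ?_))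
    (Submodule.smul_mem _ _ ?_)
  · have hX : (MvPolynomial.X i : MvPolynomial (Fin n) K) ∈
        MvPolynomial.restrictSupport K {Finsupp.single i 1} := by
      rw [MvPolynomial.X, MvPolynomial.monomial_mem_restrictSupport]
      exact Or.inl rfl
    have h2 := Submodule.mul_mem_mul h hX
    rw [← MvPolynomial.restrictSupport_add] at h2
    refine MvPolynomial.restrictSupport_mono K ?_ h2
    rintro _ ⟨c, hc, e, rfl, rfl⟩
    exact add_lt_add_left (show c < d from hc) _
  · rw [MvPolynomial.monomial_mem_restrictSupport]
    exact Or.inl hlt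
  · exact MvPolynomial.restrictSupport_mono K (fun c hc => lt_trans hc hlt) h

theorem shiftBy_monomial {K : Type*} [Field K] {n : ℕ} (b : Fin n → K) (d : Fin n →₀ ℕ) :
    shiftBy b (MvPolynomial.monomial d 1) - MvPolynomial.monomial d 1 ∈
      MvPolynomial.restrictSupport K {c | c < d} := by
  induction d using Finsupp.induction₂ with
  | zero => simp [shiftBy]
  | add_single i k d _ _ ih =>
    clear * - ih
    induction k with
    | zero => simpa using ih
    | succ k ihk =>
      rw [Finsupp.single_add, ← add_assoc]
      exact shiftBy_step b _ i ihk

theorem shiftBy_support {K : Type*} [Field K] {n : ℕ} (b : Fin n → K)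
    (f : MvPolynomial (Fin n) K) :
    shiftBy b f - f ∈ MvPolynomial.restrictSupport K {c | ∃ d ∈ f.support, c < d} := by
  have h : shiftBy b f - f = ∑ d ∈ f.support, MvPolynomial.coeff d f •
      (shiftBy b (MvPolynomial.monomial d 1) - MvPolynomial.monomial d 1) := by
    simp only [smul_sub, Finset.sum_sub_distrib, ← map_smul, ← map_sum]
    simp only [smul_eq_mul, mul_one, ← MvPolynomial.as_sum]
  rw [h]
  refine Submodule.sum_mem _ fun d hd => Submodule.smul_mem _ _ ?_
  refine MvPolynomial.restrictSupport_mono K (s := {c | c < d}) ?_ (shiftBy_monomial b d)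
  exact fun c hc => ⟨d, hd, hc⟩

theorem core {K : Type*} [Field K] [Infinite K] {n : ℕ} (A : Set (Fin n → K))
    (h0 : (0 : Fin n → K) ∈ A) (S : Set (Fin n →₀ ℕ)) (hS : IsLowerSet S)
    (hadd : ∀ f ∈ polyIdeal A, f ∈ MvPolynomial.restrictSupport K S →
      (∀ x y, MvPolynomial.eval (x + y) f = MvPolynomial.eval x f + MvPolynomial.eval y f) →
      f = 0)
    (hA : ∀ x ∈ A, ∀ y ∈ A, x + y ∈ A)
    (N : ℕ) : ∀ f ∈ polyIdeal A, (∀ c ∈ f.support, c ∈ S ∧ c.degree < N) → f = 0 := by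
  induction N with
  | zero =>
    intro f _ h
    rw [← MvPolynomial.support_eq_empty, Finset.eq_empty_iff_forall_notMem]
    intro c hc
    exact absurd (h c hc).2 (by omega)
  | succ N ih =>
    intro f hf h
    by_cases hconst : ∀ d ∈ f.support, d = 0
    · have hfC : f = MvPolynomial.C (MvPolynomial.coeff 0 f) := by
        ext d
        rw [MvPolynomial.coeff_C]
        split_ifs with hd
        · rw [hd]
        · by_contra hne
          exact hd (hconst d (MvPolynomial.mem_support_iff.mpr hne)).symm
      have := hf 0 h0
      rw [hfC] at this
      rw [hfC]
      simpa using this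
    push Not at hconst
    obtain ⟨d0, hd0, hd0'⟩ := hconst
    have hlow : ∀ q ∈ MvPolynomial.restrictSupport K {c | ∃ d ∈ f.support, c < d},
        q ∈ polyIdeal A → q = 0 := by
      intro q hq hqI
      refine ih q hqI fun c hc => ?_
      obtain ⟨d, hd, hcd⟩ := (MvPolynomial.mem_restrictSupport_iff K).mp hq hc
      have := h d hd
      refine ⟨hS hcd.le this.1, ?_⟩
      have hlt : c.degree < d.degree := by
        obtain ⟨e, rfl⟩ := exists_add_of_le hcd.le
        have he : e ≠ 0 := by
          rintro rfl
          simp at hcd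
        have he' : e.degree ≠ 0 := fun h' => he ((Finsupp.degree_eq_zero_iff e).mp h')
        rw [map_add]
        omega
      omega
    have hinv : ∀ a ∈ A, ∀ x, MvPolynomial.eval (x + a) f = MvPolynomial.eval x f := by
      intro a ha x
      have := hlow _ (shiftBy_support a f) (by
        intro y hy
        rw [map_sub, eval_shiftBy, hf _ (hA y hy a ha), hf y hy, sub_zero])
      rw [← eval_shiftBy, sub_eq_zero.mp this]
    refine hadd f hf ((MvPolynomial.mem_restrictSupport_iff K).mpr fun c hc => (h c hc).1) ?_
    intro x b
    have := hlow (shiftBy b f - f - MvPolynomial.C (MvPolynomial.eval b f))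
      (Submodule.sub_mem _ (shiftBy_support b f) (by
        rw [← MvPolynomial.monomial_zero', MvPolynomial.monomial_mem_restrictSupport]
        exact Or.inl ⟨d0, hd0, pos_iff_ne_zero.mpr hd0'⟩)) (by
        intro a ha
        rw [map_sub, map_sub, eval_shiftBy, MvPolynomial.eval_C, hf a ha, add_comm a b,
          hinv a ha b]
        ring)
    have h2 := congrArg (MvPolynomial.eval x) this
    rw [map_sub, map_sub, eval_shiftBy, MvPolynomial.eval_C, map_zero] at h2
    linear_combination h2

/-- over an algebraically closed field `K` of characteristic `p > 0`, the
ideal of polynomial relations of an additive subgroup `A ⊆ K^n` is generated by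
polynomial relations of weak Frobenius type. -/
theorem stmt_15 {K : Type*} [Field K] [IsAlgClosed K] {p : ℕ} [CharP K p] (hp : 0 < p)
    {n : ℕ} (A : Set (Fin n → K))
    (h0 : (0 : Fin n → K) ∈ A)
    (hadd : ∀ x ∈ A, ∀ y ∈ A, x + y ∈ A)
    (hneg : ∀ x ∈ A, -x ∈ A) :
    Ideal.span {f | f ∈ polyIdeal A ∧ WeakFrobeniusType p f} = polyIdeal A := by
  have hinf : Infinite K := IsAlgClosed.instInfinite
  have hpp : p.Prime := (CharP.char_is_prime_or_zero K p).resolve_right hp.ne'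
  have hle : Ideal.span {f | f ∈ polyIdeal A ∧ WeakFrobeniusType p f} ≤ polyIdeal A :=
    Ideal.span_le.mpr fun f hf => hf.1
  refine le_antisymm hle fun f hf => ?_
  set J := Ideal.span {f | f ∈ polyIdeal A ∧ WeakFrobeniusType p f} with hJ
  let m : MonomialOrder (Fin n) := MonomialOrder.lex
  let B : Set (MvPolynomial (Fin n) K) := {b | b ∈ J ∧ b ≠ 0}
  obtain ⟨g, r, hfr, -, hr⟩ := m.div_set (B := B)
    (fun b hb => (m.leadingCoeff_ne_zero_iff.mpr hb.2).isUnit) f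
  have hlin : Finsupp.linearCombination _ (fun (b : B) ↦ (b : MvPolynomial (Fin n) K)) g ∈ J := by
    rw [Finsupp.linearCombination_apply]
    exact Submodule.sum_mem _ fun b _ => Submodule.smul_mem _ _ b.2.1
  have hrI : r ∈ polyIdeal A := by
    have : r = f - Finsupp.linearCombination _ (fun (b : B) ↦ (b : MvPolynomial (Fin n) K)) g := by
      rw [hfr]; ring
    rw [this]
    exact Submodule.sub_mem _ hf (hle hlin)
  have hr0 : r = 0 := by
    refine core A h0 {c | ∀ b ∈ B, ¬ m.degree b ≤ c}
      (fun c d hdc hc b hb hbd => hc b hb (hbd.trans hdc)) ?_ hadd (r.totalDegree + 1) r hrI ?_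
    · intro q hq hqS hqadd
      by_contra hq0
      have hqB : q ∈ B := ⟨Ideal.subset_span ⟨hq, additive_weak hpp q hqadd⟩, hq0⟩
      exact (MvPolynomial.mem_restrictSupport_iff K).mp hqS (m.degree_mem_support hq0) q hqB le_rfl
    · intro c hc
      refine ⟨hr c hc, Nat.lt_succ_of_le ?_⟩
      exact MvPolynomial.le_totalDegree hc
  rw [hfr, hr0, add_zero]
  exact hlin
end
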